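/- Subdivision gadget: There is a universal constant c₀ > 0 with the following property. Let R be a register of qubits, H_else Hermitian on R, and let P_A and P_B be Hermitian operators on R acting nontrivially on disjoint sets of qubits (so P_A and P_B commute). Adjoin one ancilla qubit t and define H₀ := |1⟩⟨1|_t, H₁ := H_else + (1/2)(P_A² + P_B²), and H₂ := (1/√2)(P_A − P_B)⊗X_t. Then for all ε, η ∈ (0,1] and all Δ ≥ c₀(Λ⁶/ε² + Λ²/η²), where Λ := max(‖H₁‖, ‖H₂‖, 1), the Hamiltonian H̃ := Δ·H₀ + H₁ + √Δ·H₂ is a (Δ/2, η, ε)-simulation of H_target := H_else + P_A·P_B with product encoding, with ancilla state |anc⟩ = |0⟩_t. -/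

import Mathlib

open Matrix
open scoped Kronecker ComplexOrder

namespace QSim

/-- Index set for the computational basis of `n` qubits. -/
abbrev QIdx (n : ℕ) := Fin n → Fin 2

/-- Operators (matrices) on the Hilbert space of `n` qubits. -/
abbrev QOp (n : ℕ) := Matrix (QIdx n) (QIdx n) ℂ

/-- The operator (`ℓ²→ℓ²`) norm of a (possibly rectangular) matrix. -/
noncomputable def opNorm {I J : Type*} [Fintype I] [Fintype J] [DecidableEq J]
    (M : Matrix I J ℂ) : ℝ :=
  ‖LinearMap.toContinuousLinearMap (Matrix.toEuclideanLin M)‖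

/-- A two-qubit operator `E` placed on qubits `i` and `j` of an `n`-qubit register
(identity elsewhere), given entrywise. -/
def twoQubitOp (n : ℕ) (i j : Fin n) (E : Fin 2 → Fin 2 → Fin 2 → Fin 2 → ℂ) : QOp n :=
  fun x y => E (x i) (x j) (y i) (y j) * (if ∀ k, k ≠ i → k ≠ j → x k = y k then 1 else 0)

/-- A single-qubit operator `E` placed on qubit `i` of an `n`-qubit register. -/
def oneQubitOp (n : ℕ) (i : Fin n) (E : Matrix (Fin 2) (Fin 2) ℂ) : QOp n :=
  fun x y => E (x i) (y i) * (if ∀ k, k ≠ i → x k = y k then 1 else 0)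

/-- Sign used to build `(|01⟩ - |10⟩)/√2`. -/
def sgnE (a b : Fin 2) : ℂ :=
  if a = 0 ∧ b = 1 then 1 else if a = 1 ∧ b = 0 then -1 else 0

/-- Entries of the two-qubit projector `P` onto `span{(|01⟩-|10⟩)/√2, |11⟩}`:
`P = (1/2)(|01⟩-|10⟩)(⟨01|-⟨10|) + |11⟩⟨11|`. -/
noncomputable def Pentry (a b c d : Fin 2) : ℂ :=
  (1 / 2) * sgnE a b * sgnE c d + (if a = 1 ∧ b = 1 ∧ c = 1 ∧ d = 1 then 1 else 0)

/-- `H_{W,0} = Σ_{i=1}^{n-1} P_{i,i+1}`. -/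
noncomputable def HW0 (n : ℕ) : QOp n :=
  ∑ i : Fin (n - 1),
    twoQubitOp n ⟨i.1, by have := i.2; omega⟩ ⟨i.1 + 1, by have := i.2; omega⟩ Pentry

/-- The all-zeros state `|0…0⟩`. -/
def ket0 (n : ℕ) : QIdx n → ℂ := fun x => if ∀ k, x k = 0 then 1 else 0

/-- The generalized W state `|W_n⟩ = n^{-1/2} Σ_i |e_i⟩`. -/
noncomputable def Wstate (n : ℕ) : QIdx n → ℂ := fun x =>
  if (Finset.univ.filter fun k => x k = 1).card = 1 then (((Real.sqrt n)⁻¹ : ℝ) : ℂ) else 0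

end QSim

namespace QSim

/-- The Pauli `Z` matrix. -/
noncomputable def Zmat : Matrix (Fin 2) (Fin 2) ℂ := !![1, 0; 0, -1]

/-- The Pauli `X` matrix. -/
noncomputable def Xmat : Matrix (Fin 2) (Fin 2) ℂ := !![0, 1; 1, 0]

/-- The W-state parent Hamiltonian `H_W = Γ·H_{W,0} + 1 - Σ_{i=1}^n (1 - Z_i)/2`. -/
noncomputable def HWham (n : ℕ) (Γ : ℝ) : QOp n :=
  (Γ : ℂ) • HW0 n + 1 - ∑ i : Fin n, oneQubitOp n i ((1 - Zmat) / 2)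

end QSim

namespace QSim

open scoped Classical in
/-- The spectral projector of a Hermitian matrix onto the span of its eigenvectors with
eigenvalue strictly below `Δ` (junk value `0` if the matrix is not Hermitian). -/
noncomputable def specProjBelow {I : Type*} [Fintype I] [DecidableEq I]
    (M : Matrix I I ℂ) (Δ : ℝ) : Matrix I I ℂ :=
  if hM : M.IsHermitian then
    (hM.eigenvectorUnitary : Matrix I I ℂ) *
      Matrix.diagonal (fun k => if hM.eigenvalues k < Δ then (1 : ℂ) else 0) *
      (hM.eigenvectorUnitary : Matrix I I ℂ)ᴴ
  else 0

/-- The isometry `T : ψ ↦ ψ ⊗ |anc⟩` from `ℋ` into `ℋ⊗𝒜`, as a rectangular matrix. -/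
def prodIso {I J : Type*} [DecidableEq I] (anc : J → ℂ) : Matrix (I × J) I ℂ :=
  fun p i => if p.1 = i then anc p.2 else 0

/-- `H_s` (on `ℋ⊗𝒜`) is a `(Δ,η,ε)`-simulation of `H_t` (on `ℋ`) with product encoding,
witnessed by the isometry `T̃`: `|anc⟩` is a unit vector, `T̃` is an isometry with range the
eigenspace of `H_s` of energies `< Δ`, `‖T̃ - (·⊗|anc⟩)‖ ≤ η`, and
`‖P H_s P - T̃ H_t T̃†‖ ≤ ε` where `P` is the spectral projector below `Δ`. -/
noncomputable def IsSimulationWith {I J : Type*} [Fintype I] [DecidableEq I]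
    [Fintype J] [DecidableEq J]
    (Hs : Matrix (I × J) (I × J) ℂ) (Ht : Matrix I I ℂ) (anc : J → ℂ)
    (Tt : Matrix (I × J) I ℂ) (Δ η ε : ℝ) : Prop :=
  star anc ⬝ᵥ anc = 1 ∧
  Ttᴴ * Tt = 1 ∧
  Tt * Ttᴴ = specProjBelow Hs Δ ∧
  opNorm (Tt - prodIso anc) ≤ η ∧
  opNorm (specProjBelow Hs Δ * Hs * specProjBelow Hs Δ - Tt * Ht * Ttᴴ) ≤ ε

/-- `H_s` is a `(Δ,η,ε)`-simulation of `H_t` with product encoding (ancilla state `anc`). -/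
noncomputable def IsSimulation {I J : Type*} [Fintype I] [DecidableEq I]
    [Fintype J] [DecidableEq J]
    (Hs : Matrix (I × J) (I × J) ℂ) (Ht : Matrix I I ℂ) (anc : J → ℂ) (Δ η ε : ℝ) : Prop :=
  ∃ Tt : Matrix (I × J) I ℂ, IsSimulationWith Hs Ht anc Tt Δ η ε

end QSim

namespace QSim

/-- `M` acts nontrivially only on the qubits in `S` (i.e. `M = M_S ⊗ I` on the rest). -/
def ActsOn {ι : Type*} [Fintype ι] [DecidableEq ι]
    (M : Matrix (ι → Fin 2) (ι → Fin 2) ℂ) (S : Finset ι) : Prop :=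
  ∃ f : ({k // k ∈ S} → Fin 2) → ({k // k ∈ S} → Fin 2) → ℂ,
    ∀ x y, M x y
      = (if ∀ k ∉ S, x k = y k then 1 else 0) * f (fun k => x k.1) (fun k => y k.1)

/-- The projector `|0⟩⟨0|` on one qubit. -/
noncomputable def proj0 : Matrix (Fin 2) (Fin 2) ℂ := !![1, 0; 0, 0]

/-- The projector `|1⟩⟨1|` on one qubit. -/
noncomputable def proj1 : Matrix (Fin 2) (Fin 2) ℂ := !![0, 0; 0, 1]

/-- The state `|0⟩` of the ancilla qubit. -/
def anc0 : Fin 2 → ℂ := fun t => if t = 0 then 1 else 0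

end QSim

section

open scoped Matrix.Norms.L2Operator

namespace QSim

/-- A Riccati equation with a dominant linear term has a small solution. -/
theorem exists_riccati_solution {A : Type*} [NormedRing A] [NormedAlgebra ℂ A] [CompleteSpace A]
    (a b : A) {s L : ℝ} (hs : 0 < s) (hL : 1 ≤ L) (ha : ‖a‖ ≤ L) (hb : ‖b‖ ≤ L)
    (hsL : 12 * L ^ 2 ≤ s ^ 2) :
    ∃ x : A, ‖x‖ ≤ 2 * L / s ∧
      (s : ℂ) ^ 2 • x + (s : ℂ) • b + a * x = x * a + (s : ℂ) • (x * b * x) := by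
  have hL0 : 0 < L := by linarith
  have hs0 : (s : ℂ) ≠ 0 := by exact_mod_cast hs.ne'
  have hns : ‖(s : ℂ)‖ = s := by simp [abs_of_pos hs]
  set r := 2 * L / s with hr
  have hr0 : 0 < r := by positivity
  have hrs : r * s = 2 * L := by rw [hr]; field_simp
  set f : A → A := fun x => ((s : ℂ) ^ 2)⁻¹ • (x * a + (s : ℂ) • (x * b * x) - (s : ℂ) • b - a * x)
    with hf
  have hinv : ∀ (y : A) (c : ℝ), ‖y‖ ≤ s ^ 2 * c → ‖((s : ℂ) ^ 2)⁻¹ • y‖ ≤ c := by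
    intro y c h
    rw [norm_smul, norm_inv, norm_pow, hns, inv_mul_le_iff₀ (by positivity)]
    exact h
  have hmaps : Set.MapsTo f (Metric.closedBall 0 r) (Metric.closedBall 0 r) := by
    intro x hx
    rw [mem_closedBall_zero_iff] at hx ⊢
    refine hinv _ _ ?_
    have h1 : ‖x * a‖ ≤ r * L := (norm_mul_le _ _).trans (by gcongr)
    have h2 : ‖a * x‖ ≤ L * r := (norm_mul_le _ _).trans (by gcongr)
    have h3 : ‖(s : ℂ) • b‖ ≤ s * L := by rw [norm_smul, hns]; gcongr
    have h4 : ‖(s : ℂ) • (x * b * x)‖ ≤ s * (r * L * r) := by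
      rw [norm_smul, hns]
      gcongr
      exact (norm_mul_le _ _).trans
        (mul_le_mul ((norm_mul_le _ _).trans (by gcongr)) hx (norm_nonneg _) (by positivity))
    calc _ ≤ ‖x * a‖ + ‖(s : ℂ) • (x * b * x)‖ + ‖(s : ℂ) • b‖ + ‖a * x‖ :=
          (norm_sub_le _ _).trans (add_le_add ((norm_sub_le _ _).trans
            (add_le_add (norm_add_le _ _) le_rfl)) le_rfl)
      _ ≤ r * L + s * (r * L * r) + s * L + L * r := by gcongr
      _ = (r * s) * L * r + s * L + 2 * L * r := by ring
      _ ≤ s ^ 2 * r := by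
          rw [hrs]
          have h5 : s * L = s ^ 2 * r / 2 := by linear_combination (-s / 2) * hrs
          have h6 : L * r ≤ L ^ 2 * r := by gcongr; nlinarith
          nlinarith [mul_le_mul_of_nonneg_right hsL hr0.le]
  have hlip : LipschitzWith (1 / 2) (hmaps.restrict f _ _) := by
    refine LipschitzWith.of_dist_le_mul ?_
    rintro ⟨x, hx⟩ ⟨y, hy⟩
    rw [mem_closedBall_zero_iff] at hx hy
    change dist (f x) (f y) ≤ ((1 / 2 : NNReal) : ℝ) * dist x y
    rw [dist_eq_norm, dist_eq_norm]
    have e : f x - f y = ((s : ℂ) ^ 2)⁻¹ • ((x - y) * a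
        + (s : ℂ) • ((x - y) * b * x + y * b * (x - y)) - a * (x - y)) := by
      simp only [hf, ← smul_sub]
      congr 1
      have : x * b * x - y * b * y = (x - y) * b * x + y * b * (x - y) := by noncomm_ring
      rw [← this, smul_sub]
      noncomm_ring
    rw [e]
    refine hinv _ _ ?_
    set d := ‖x - y‖
    have h1 : ‖(x - y) * a‖ ≤ d * L := (norm_mul_le _ _).trans (by gcongr)
    have h2 : ‖a * (x - y)‖ ≤ L * d := (norm_mul_le _ _).trans (by gcongr)
    have h3 : ‖(x - y) * b * x‖ ≤ d * L * r :=
      (norm_mul_le _ _).trans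
        (mul_le_mul ((norm_mul_le _ _).trans (by gcongr)) hx (norm_nonneg _) (by positivity))
    have h4 : ‖y * b * (x - y)‖ ≤ r * L * d :=
      (norm_mul_le _ _).trans
        (mul_le_mul ((norm_mul_le _ _).trans (by gcongr)) le_rfl (norm_nonneg _) (by positivity))
    calc _ ≤ ‖(x - y) * a‖ + s * (‖(x - y) * b * x‖ + ‖y * b * (x - y)‖) + ‖a * (x - y)‖ := by
          refine (norm_sub_le _ _).trans (add_le_add ((norm_add_le _ _).trans
            (add_le_add le_rfl ?_)) le_rfl)
          rw [norm_smul, hns]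
          gcongr
          exact norm_add_le _ _
      _ ≤ d * L + s * (d * L * r + r * L * d) + L * d := by gcongr
      _ = 2 * L * d + 2 * (r * s) * L * d := by ring
      _ ≤ s ^ 2 * (((1 / 2 : NNReal) : ℝ) * d) := by
          rw [hrs]
          have h6 : L * d ≤ L ^ 2 * d := by gcongr; nlinarith
          have h7 : ((1 / 2 : NNReal) : ℝ) = 1 / 2 := by simp
          rw [h7]
          nlinarith [mul_le_mul_of_nonneg_right hsL (norm_nonneg (x - y))]
  have hK : ContractingWith (1 / 2) (hmaps.restrict f _ _) :=
    ⟨by rw [← NNReal.coe_lt_coe]; norm_num, hlip⟩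
  obtain ⟨x, hx, hfix, -⟩ := hK.exists_fixedPoint' (x := 0) Metric.isClosed_closedBall.isComplete
    hmaps (by simp [hr0.le]) (edist_ne_top _ _)
  refine ⟨x, by simpa using hx, ?_⟩
  have h : f x = x := hfix
  have h2 : (s : ℂ) ^ 2 • x = x * a + (s : ℂ) • (x * b * x) - (s : ℂ) • b - a * x := by
    conv_lhs => rw [← h]
    simp only [hf]
    rw [smul_inv_smul₀ (pow_ne_zero 2 hs0)]
  rw [h2]
  abel

theorem norm_one_le_one {I : Type*} [Fintype I] [DecidableEq I] :
    ‖(1 : Matrix I I ℂ)‖ ≤ 1 := by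
  rw [← Matrix.diagonal_one, Matrix.l2_opNorm_diagonal]
  exact (pi_norm_le_iff_of_nonneg zero_le_one).2 fun i => by simp

theorem norm_le_one_of_isometry {I K : Type*} [Fintype I] [DecidableEq I] [Fintype K]
    [DecidableEq K] {E : Matrix K I ℂ} (h : Eᴴ * E = 1) : ‖E‖ ≤ 1 := by
  have h1 := Matrix.l2_opNorm_conjTranspose_mul_self E
  rw [h] at h1
  nlinarith [norm_one_le_one (I := I), norm_nonneg E]

theorem eq_zero_of_mulVec_eq_smul {I : Type*} [Fintype I] [DecidableEq I] {A : Matrix I I ℂ}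
    {v : I → ℂ} {c : ℂ} (h : A *ᵥ v = c • v) (hc : ‖A‖ < ‖c‖) : v = 0 := by
  have h1 := Matrix.l2_opNorm_mulVec A (WithLp.toLp 2 v)
  have h2 : (EuclideanSpace.equiv I ℂ).symm (A *ᵥ v) = c • WithLp.toLp 2 v := by rw [h]; rfl
  change ‖(EuclideanSpace.equiv I ℂ).symm (A *ᵥ v)‖ ≤ _ at h1
  rw [h2, norm_smul] at h1
  have h3 : ‖WithLp.toLp 2 v‖ = 0 := by
    by_contra hne
    have : 0 < ‖WithLp.toLp 2 v‖ := lt_of_le_of_ne (norm_nonneg _) (Ne.symm hne)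
    nlinarith
  have := norm_eq_zero.1 h3
  exact congrArg WithLp.ofLp this

/-- An invertible square root of `1 + XᴴX`, with bounds on the distance to the identity. -/
theorem exists_sqrt_one_add {I : Type*} [Fintype I] [DecidableEq I] (X : Matrix I I ℂ) :
    ∃ M N : Matrix I I ℂ, Nᴴ = N ∧ M * N = 1 ∧ N * M = 1 ∧ M * M = 1 + Xᴴ * X ∧
      ‖N‖ ≤ 1 ∧ ‖M - 1‖ ≤ ‖X‖ ^ 2 ∧ ‖N - 1‖ ≤ ‖X‖ ^ 2 := by
  have hp : (Xᴴ * X).PosSemidef := Matrix.posSemidef_conjTranspose_mul_self X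
  set d := hp.1.eigenvalues with hd
  have hd0 : ∀ i, 0 ≤ d i := hp.eigenvalues_nonneg
  set U := hp.1.eigenvectorUnitary with hU
  have hUU : (U : Matrix I I ℂ)ᴴ * (U : Matrix I I ℂ) = 1 := Unitary.coe_star_mul_self U
  have hUU' : (U : Matrix I I ℂ) * (U : Matrix I I ℂ)ᴴ = 1 := Unitary.coe_mul_star_self U
  have hX : Xᴴ * X = U * diagonal (fun i => (d i : ℂ)) * (U : Matrix I I ℂ)ᴴ := by
    have := hp.1.spectral_theorem
    rw [Unitary.conjStarAlgAut_apply] at this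
    exact this
  let D : (I → ℝ) → Matrix I I ℂ := fun g =>
    U * diagonal (fun i => (g i : ℂ)) * (U : Matrix I I ℂ)ᴴ
  have hDmul : ∀ g h, D g * D h = D (fun i => g i * h i) := by
    intro g h
    have : D g * D h = U * diagonal (fun i => (g i : ℂ)) * ((U : Matrix I I ℂ)ᴴ * U)
        * diagonal (fun i => (h i : ℂ)) * (U : Matrix I I ℂ)ᴴ := by
      simp only [D, Matrix.mul_assoc]
    rw [this, hUU, Matrix.mul_one, Matrix.mul_assoc _ (diagonal _) (diagonal _),
      Matrix.diagonal_mul_diagonal]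
    simp only [D, Complex.ofReal_mul]
  have hDone : D (fun _ => 1) = 1 := by simp [D, hUU']
  have hDstar : ∀ g, (D g)ᴴ = D g := by
    intro g
    simp only [D, Matrix.conjTranspose_mul, Matrix.conjTranspose_conjTranspose,
      Matrix.diagonal_conjTranspose, Matrix.mul_assoc]
    congr 3
    ext i
    simp
  have hDsub : ∀ g h, D g - D h = D (fun i => g i - h i) := by
    intro g h
    simp only [D, ← Matrix.sub_mul, ← Matrix.mul_sub, Matrix.diagonal_sub, Complex.ofReal_sub]
  have hDadd : ∀ g h, D g + D h = D (fun i => g i + h i) := by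
    intro g h
    simp only [D, ← Matrix.add_mul, ← Matrix.mul_add, Matrix.diagonal_add, Complex.ofReal_add]
  have hDnorm : ∀ g, ‖D g‖ = ‖(fun i => (g i : ℂ))‖ := by
    intro g
    have h1 : ‖D g‖ = ‖(U : Matrix I I ℂ) * diagonal (fun i => (g i : ℂ))‖ := by
      exact CStarRing.norm_mul_coe_unitary _ (star U)
    rw [h1, CStarRing.norm_coe_unitary_mul, Matrix.l2_opNorm_diagonal]
  have hDX : Xᴴ * X = D d := hX
  have hdX : ∀ i, d i ≤ ‖X‖ ^ 2 := by
    intro i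
    rw [pow_two, ← Matrix.l2_opNorm_conjTranspose_mul_self, hDX, hDnorm]
    have := norm_le_pi_norm (fun i => (d i : ℂ)) i
    simpa [abs_of_nonneg (hd0 i)] using this
  have hle : ∀ (g : I → ℝ) (c : ℝ), 0 ≤ c → (∀ i, |g i| ≤ c) → ‖D g‖ ≤ c := by
    intro g c hc h
    rw [hDnorm]
    exact (pi_norm_le_iff_of_nonneg hc).2 fun i => by simpa using h i
  have hsq : ∀ i, √(1 + d i) * √(1 + d i) = 1 + d i := fun i =>
    Real.mul_self_sqrt (by linarith [hd0 i])
  have hge : ∀ i, 1 ≤ √(1 + d i) := fun i => Real.one_le_sqrt.2 (by linarith [hd0 i])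
  have hinv : ∀ i, √(1 + d i) * (√(1 + d i))⁻¹ = 1 := fun i =>
    mul_inv_cancel₀ (by linarith [hge i])
  have hinv1 : ∀ i, (√(1 + d i))⁻¹ ≤ 1 := fun i => inv_le_one_of_one_le₀ (hge i)
  have hinv0 : ∀ i, 0 ≤ (√(1 + d i))⁻¹ := fun i => by positivity
  refine ⟨D fun i => √(1 + d i), D fun i => (√(1 + d i))⁻¹, hDstar _, ?_, ?_, ?_, ?_, ?_,
    ?_⟩
  · rw [hDmul, ← hDone]
    exact congrArg D (funext hinv)
  · rw [hDmul, ← hDone]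
    exact congrArg D (funext fun i => by rw [mul_comm, hinv])
  · rw [hDmul, hDX, ← hDone, hDadd]
    exact congrArg D (funext hsq)
  · exact hle _ _ zero_le_one fun i => by rw [abs_of_nonneg (hinv0 i)]; exact hinv1 i
  · rw [← hDone, hDsub]
    refine hle _ _ (by positivity) fun i => ?_
    rw [abs_of_nonneg (by linarith [hge i])]
    nlinarith [hge i, hsq i, hdX i]
  · rw [← hDone, hDsub]
    refine hle _ _ (by positivity) fun i => ?_
    rw [abs_of_nonpos (by linarith [hinv1 i])]
    nlinarith [hge i, hsq i, hdX i, hinv i, hinv0 i, hinv1 i]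

/-- A matrix that fixes low-energy eigenvectors and kills the others is the spectral projector. -/
theorem specProjBelow_eq {I : Type*} [Fintype I] [DecidableEq I] {M Q : Matrix I I ℂ} {Δ : ℝ}
    (hM : M.IsHermitian)
    (hlow : ∀ (l : ℝ) (v : I → ℂ), M *ᵥ v = (l : ℂ) • v → l < Δ → Q *ᵥ v = v)
    (hhigh : ∀ (l : ℝ) (v : I → ℂ), M *ᵥ v = (l : ℂ) • v → Δ ≤ l → Q *ᵥ v = 0) :
    specProjBelow M Δ = Q := by
  rw [specProjBelow, dif_pos hM]
  set U := hM.eigenvectorUnitary with hU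
  have hUU' : (U : Matrix I I ℂ) * (U : Matrix I I ℂ)ᴴ = 1 := Unitary.coe_mul_star_self U
  have key : (U : Matrix I I ℂ) * diagonal (fun k => if hM.eigenvalues k < Δ then (1 : ℂ) else 0)
      = Q * U := by
    ext i k
    have hv : M *ᵥ ⇑(hM.eigenvectorBasis k)
        = ((hM.eigenvalues k : ℝ) : ℂ) • ⇑(hM.eigenvectorBasis k) := hM.mulVec_eigenvectorBasis k
    have hQ : (Q * (U : Matrix I I ℂ)) i k = (Q *ᵥ ⇑(hM.eigenvectorBasis k)) i := rfl
    rw [hQ, Matrix.mul_diagonal]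
    split_ifs with hk
    · rw [hlow _ _ hv hk, mul_one]
      rfl
    · rw [hhigh _ _ hv (not_lt.1 hk), mul_zero]
      rfl
  rw [key, Matrix.mul_assoc, hUU', Matrix.mul_one]

theorem ActsOn.mul_apply {ι : Type*} [Fintype ι] [DecidableEq ι]
    {P Q : Matrix (ι → Fin 2) (ι → Fin 2) ℂ} {S T : Finset ι} (hST : Disjoint S T)
    {f : ({k // k ∈ S} → Fin 2) → ({k // k ∈ S} → Fin 2) → ℂ}
    {g : ({k // k ∈ T} → Fin 2) → ({k // k ∈ T} → Fin 2) → ℂ}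
    (hP : ∀ x y, P x y
      = (if ∀ k ∉ S, x k = y k then 1 else 0) * f (fun k => x k.1) (fun k => y k.1))
    (hQ : ∀ x y, Q x y
      = (if ∀ k ∉ T, x k = y k then 1 else 0) * g (fun k => x k.1) (fun k => y k.1))
    (x y : ι → Fin 2) :
    (P * Q) x y = (if ∀ k, k ∉ S → k ∉ T → x k = y k then 1 else 0) *
      (f (fun k => x k.1) (fun k => y k.1) * g (fun k => x k.1) (fun k => y k.1)) := by
  rw [Matrix.mul_apply, Finset.sum_eq_single (fun k => if k ∈ S then y k else x k)]
  · rw [hP, hQ, if_pos (by intro k hk; simp [hk])]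
    have h1 : (fun k : {k // k ∈ S} => if k.1 ∈ S then y k.1 else x k.1) = fun k => y k.1 := by
      ext k; simp [k.2]
    have h2 : (fun k : {k // k ∈ T} => if k.1 ∈ S then y k.1 else x k.1) = fun k => x k.1 := by
      ext k; simp [Finset.disjoint_right.1 hST k.2]
    have h3 : (∀ k ∉ T, (if k ∈ S then y k else x k) = y k) ↔
        ∀ k, k ∉ S → k ∉ T → x k = y k := by
      refine forall_congr' fun k => ?_
      by_cases hk : k ∈ S <;> simp [hk]
    rw [h1, h2, if_congr h3 rfl rfl]
    ring
  · intro z _ hz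
    rw [hP, hQ]
    by_cases h1 : ∀ k ∉ S, x k = z k
    · by_cases h2 : ∀ k ∉ T, z k = y k
      · exfalso
        apply hz
        ext k : 1
        by_cases hk : k ∈ S
        · simp [hk, h2 k (Finset.disjoint_left.1 hST hk)]
        · simp [hk, h1 k hk]
      · rw [if_neg h2]; ring
    · rw [if_neg h1]; ring
  · simp

theorem ActsOn.commute {ι : Type*} [Fintype ι] [DecidableEq ι]
    {P Q : Matrix (ι → Fin 2) (ι → Fin 2) ℂ} {S T : Finset ι} (hST : Disjoint S T)
    (hP : ActsOn P S) (hQ : ActsOn Q T) : P * Q = Q * P := by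
  obtain ⟨f, hf⟩ := hP
  obtain ⟨g, hg⟩ := hQ
  ext x y
  rw [ActsOn.mul_apply hST hf hg, ActsOn.mul_apply hST.symm hg hf]
  have h : (∀ k, k ∉ S → k ∉ T → x k = y k) ↔ ∀ k, k ∉ T → k ∉ S → x k = y k :=
    ⟨fun h k a b => h k b a, fun h k a b => h k b a⟩
  rw [if_congr h rfl rfl, mul_comm (f _ _)]

end QSim

namespace QSim

set_option maxHeartbeats 800000 in
/-- The low-energy subspace of a block Hamiltonian `[[a, s b], [s b, s² + a]]` is a graph over the
first block, on which the Hamiltonian is close to `a - b²`. -/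
theorem exists_isometry_low_energy {I K : Type*} [Fintype I] [DecidableEq I] [Fintype K]
    [DecidableEq K] {E₀ E₁ : Matrix K I ℂ} {H : Matrix K K ℂ} {a b : Matrix I I ℂ} {s L : ℝ}
    (hH : H.IsHermitian) (h00 : E₀ᴴ * E₀ = 1) (h11 : E₁ᴴ * E₁ = 1) (h01 : E₀ᴴ * E₁ = 0)
    (h10 : E₁ᴴ * E₀ = 0) (hE : E₀ * E₀ᴴ + E₁ * E₁ᴴ = 1)
    (hHE₀ : H * E₀ = E₀ * a + (s : ℂ) • (E₁ * b))
    (hHE₁ : H * E₁ = (s : ℂ) • (E₀ * b) + (s : ℂ) ^ 2 • E₁ + E₁ * a)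
    (hs : 0 < s) (hL : 1 ≤ L) (ha : ‖a‖ ≤ L) (hb : ‖b‖ ≤ L) (hsL : 16 * L ^ 2 ≤ s ^ 2) :
    ∃ T : Matrix K I ℂ, Tᴴ * T = 1 ∧ T * Tᴴ = specProjBelow H (s ^ 2 / 2) ∧
      ‖T - E₀‖ ≤ 4 * L / s ∧ ‖Tᴴ * H * T - (a - b * b)‖ ≤ 32 * L ^ 4 / s ^ 2 := by
  have hL0 : 0 < L := by linarith
  have hs0 : (s : ℂ) ≠ 0 := by exact_mod_cast hs.ne'
  have hns : ‖(s : ℂ)‖ = s := by simp [abs_of_pos hs]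
  have hLL : L ≤ L ^ 2 := by nlinarith
  obtain ⟨X, hXr, hX⟩ := exists_riccati_solution a b hs hL ha hb (by nlinarith)
  obtain ⟨M, N, hNs, hMN, hNM, hMM, hN1, hM2, hN2⟩ := exists_sqrt_one_add X
  set r := 2 * L / s with hr
  have hr0 : 0 < r := by positivity
  have hrs : r * s = 2 * L := by rw [hr]; field_simp
  have hr2 : 2 * r ≤ 1 := by
    have : (2 * r) ^ 2 * s ^ 2 ≤ 1 * s ^ 2 := by
      calc (2 * r) ^ 2 * s ^ 2 = 4 * (r * s) ^ 2 := by ring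
        _ ≤ 1 * s ^ 2 := by rw [hrs]; linarith
    have := le_of_mul_le_mul_right this (by positivity)
    nlinarith
  have hXr2 : ‖X‖ ^ 2 ≤ r ^ 2 := by gcongr
  set G := E₀ + E₁ * X with hG
  set k := a + (s : ℂ) • (b * X) with hk
  have hHG : H * G = G * k := by
    have e : H * G = E₀ * a + (s : ℂ) • (E₀ * (b * X)) +
        E₁ * ((s : ℂ) ^ 2 • X + (s : ℂ) • b + a * X) := by
      rw [hG, Matrix.mul_add, ← Matrix.mul_assoc, hHE₀, hHE₁]
      simp only [Matrix.add_mul, Matrix.mul_add, Matrix.smul_mul, Matrix.mul_smul,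
        Matrix.mul_assoc]
      abel
    rw [e, hX, hG, hk]
    simp only [Matrix.add_mul, Matrix.mul_add, Matrix.mul_smul, Matrix.mul_assoc, smul_add]
    abel
  have hGh : Gᴴ = E₀ᴴ + Xᴴ * E₁ᴴ := by
    rw [hG, Matrix.conjTranspose_add, Matrix.conjTranspose_mul]
  have hGG : Gᴴ * G = M * M := by
    rw [hMM, hGh, hG, Matrix.add_mul, Matrix.mul_add, Matrix.mul_add, h00, Matrix.mul_assoc Xᴴ,
      h10, ← Matrix.mul_assoc E₀ᴴ, h01, Matrix.mul_assoc Xᴴ, ← Matrix.mul_assoc E₁ᴴ, h11]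
    simp
  have hksmall : ‖k‖ ≤ 3 * L ^ 2 := by
    calc ‖k‖ ≤ ‖a‖ + ‖(s : ℂ) • (b * X)‖ := norm_add_le _ _
      _ ≤ L + s * (L * r) := by
          rw [norm_smul, hns]
          gcongr
          exact (norm_mul_le _ _).trans (by gcongr)
      _ = L + L * (r * s) := by ring
      _ ≤ 3 * L ^ 2 := by rw [hrs]; nlinarith
  obtain ⟨T, hT⟩ : ∃ T, T = G * N := ⟨_, rfl⟩
  have hTh : Tᴴ = N * Gᴴ := by rw [hT, Matrix.conjTranspose_mul, hNs]
  have hTT : Tᴴ * T = 1 := by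
    rw [hTh, hT, Matrix.mul_assoc, ← Matrix.mul_assoc Gᴴ, hGG, Matrix.mul_assoc M, hMN,
      Matrix.mul_one, hNM]
  have hHT : H * T = T * (M * k * N) := by
    rw [hT, ← Matrix.mul_assoc, hHG]
    simp only [Matrix.mul_assoc]
    rw [← Matrix.mul_assoc N, hNM, Matrix.one_mul]
  have hTHT : Tᴴ * H * T = M * k * N := by
    rw [Matrix.mul_assoc, hHT, ← Matrix.mul_assoc, hTT, Matrix.one_mul]
  have hsym : (M * k * N)ᴴ = M * k * N := by
    rw [← hTHT, Matrix.conjTranspose_mul, Matrix.conjTranspose_mul,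
      Matrix.conjTranspose_conjTranspose, hH.eq, Matrix.mul_assoc]
  have hHQ : H * (T * Tᴴ) = (T * Tᴴ) * H := by
    have h1 : H * (T * Tᴴ) = T * (M * k * N) * Tᴴ := by rw [← hHT, Matrix.mul_assoc]
    have h2 : (T * (M * k * N) * Tᴴ)ᴴ = T * (M * k * N) * Tᴴ := by
      rw [Matrix.conjTranspose_mul, Matrix.conjTranspose_mul, hsym,
        Matrix.conjTranspose_conjTranspose, ← Matrix.mul_assoc]
    have h3 : (H * (T * Tᴴ))ᴴ = (T * Tᴴ) * H := by
      rw [Matrix.conjTranspose_mul, Matrix.conjTranspose_mul, Matrix.conjTranspose_conjTranspose,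
        hH.eq]
    rw [← h3, h1, h2]
  have hGQ : Gᴴ * (T * Tᴴ) = Gᴴ := by
    have : Gᴴ = M * Tᴴ := by rw [hTh, ← Matrix.mul_assoc, hMN, Matrix.one_mul]
    rw [this, Matrix.mul_assoc, ← Matrix.mul_assoc Tᴴ, hTT, Matrix.one_mul]
  have hHsym₁ : E₁ᴴ * H = (s : ℂ) • (bᴴ * E₀ᴴ) + (s : ℂ) ^ 2 • E₁ᴴ + aᴴ * E₁ᴴ := by
    have := congrArg Matrix.conjTranspose hHE₁
    simpa [Matrix.conjTranspose_mul, hH.eq, Matrix.conjTranspose_smul] using this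
  refine ⟨T, hTT, (specProjBelow_eq hH ?_ ?_).symm, ?_, ?_⟩
  · intro l v hv hl
    obtain ⟨w, hw⟩ : ∃ w, w = v - (T * Tᴴ) *ᵥ v := ⟨_, rfl⟩
    have hHw : H *ᵥ w = (l : ℂ) • w := by
      rw [hw, Matrix.mulVec_sub, Matrix.mulVec_mulVec, hHQ, ← Matrix.mulVec_mulVec, hv,
        Matrix.mulVec_smul, smul_sub]
    have hGw : Gᴴ *ᵥ w = 0 := by
      rw [hw, Matrix.mulVec_sub, Matrix.mulVec_mulVec, hGQ, sub_self]
    obtain ⟨x, hx⟩ : ∃ x, x = E₀ᴴ *ᵥ w := ⟨_, rfl⟩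
    obtain ⟨y, hy⟩ : ∃ y, y = E₁ᴴ *ᵥ w := ⟨_, rfl⟩
    have hxy : x = -(Xᴴ *ᵥ y) := by
      rw [hGh, Matrix.add_mulVec, ← Matrix.mulVec_mulVec, ← hx, ← hy] at hGw
      exact eq_neg_of_add_eq_zero_left hGw
    have hey : (s : ℂ) • (bᴴ *ᵥ x) + (s : ℂ) ^ 2 • y + aᴴ *ᵥ y = (l : ℂ) • y := by
      have h1 : (l : ℂ) • y = (E₁ᴴ * H) *ᵥ w := by
        rw [hy, ← Matrix.mulVec_smul, ← hHw, Matrix.mulVec_mulVec]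
      rw [h1, hHsym₁, hx, hy]
      simp only [Matrix.add_mulVec, Matrix.smul_mulVec, Matrix.mulVec_mulVec]
    have hey' : ((s : ℂ) • (bᴴ * Xᴴ) - aᴴ) *ᵥ y = ((s : ℂ) ^ 2 - l) • y := by
      rw [sub_smul, ← hey, hxy]
      simp only [Matrix.sub_mulVec, Matrix.smul_mulVec, Matrix.mulVec_mulVec, Matrix.mulVec_neg,
        smul_neg]
      abel
    have hy0 : y = 0 := by
      refine eq_zero_of_mulVec_eq_smul hey' ?_
      have h1 : ‖(s : ℂ) • (bᴴ * Xᴴ) - aᴴ‖ ≤ 3 * L ^ 2 := by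
        calc _ ≤ ‖(s : ℂ) • (bᴴ * Xᴴ)‖ + ‖aᴴ‖ := norm_sub_le _ _
          _ ≤ s * (L * r) + L := by
              rw [norm_smul, hns, Matrix.l2_opNorm_conjTranspose]
              gcongr
              refine (norm_mul_le _ _).trans ?_
              rw [Matrix.l2_opNorm_conjTranspose, Matrix.l2_opNorm_conjTranspose]
              gcongr
          _ = L + L * (r * s) := by ring
          _ ≤ 3 * L ^ 2 := by rw [hrs]; nlinarith
      have h2 : ‖(s : ℂ) ^ 2 - l‖ = s ^ 2 - l := by
        have : ((s : ℂ) ^ 2 - l) = ((s ^ 2 - l : ℝ) : ℂ) := by push_cast; rfl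
        rw [this, Complex.norm_real, Real.norm_eq_abs, abs_of_pos (by nlinarith)]
      rw [h2]
      nlinarith
    have hx0 : x = 0 := by rw [hxy, hy0]; simp
    have hw0 : w = 0 := by
      have : (E₀ * E₀ᴴ + E₁ * E₁ᴴ) *ᵥ w = 0 := by
        rw [Matrix.add_mulVec, ← Matrix.mulVec_mulVec, ← Matrix.mulVec_mulVec, ← hx, ← hy, hx0,
          hy0]
        simp
      rwa [hE, Matrix.one_mulVec] at this
    exact (sub_eq_zero.1 (hw.symm.trans hw0)).symm
  · intro l v hv hl
    obtain ⟨z, hz⟩ : ∃ z, z = (N * Tᴴ) *ᵥ v := ⟨_, rfl⟩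
    have hQv : (T * Tᴴ) *ᵥ v = G *ᵥ z := by
      rw [hz, Matrix.mulVec_mulVec, hT, Matrix.mul_assoc]
    have hHGz : H *ᵥ (G *ᵥ z) = (l : ℂ) • (G *ᵥ z) := by
      rw [← hQv, Matrix.mulVec_mulVec, hHQ, ← Matrix.mulVec_mulVec, hv, Matrix.mulVec_smul]
    have hkz : k *ᵥ z = (l : ℂ) • z := by
      have hleft : (N * Tᴴ) * G = 1 := by
        rw [hTh, Matrix.mul_assoc, Matrix.mul_assoc, hGG, ← Matrix.mul_assoc N M, hNM,
          Matrix.one_mul, hNM]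
      have h1 := congrArg ((N * Tᴴ) *ᵥ ·) hHGz
      simp only [Matrix.mulVec_smul] at h1
      rwa [Matrix.mulVec_mulVec _ H, hHG, Matrix.mulVec_mulVec, Matrix.mulVec_mulVec,
        ← Matrix.mul_assoc, hleft, Matrix.one_mul, Matrix.one_mulVec] at h1
    have hz0 : z = 0 := by
      refine eq_zero_of_mulVec_eq_smul hkz ?_
      rw [Complex.norm_real, Real.norm_eq_abs, abs_of_nonneg (by nlinarith)]
      nlinarith
    rw [hQv, hz0, Matrix.mulVec_zero]
  · have e : T - E₀ = E₀ * (N - 1) + E₁ * (X * N) := by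
      rw [hT, hG, Matrix.add_mul, Matrix.mul_sub, Matrix.mul_one, Matrix.mul_assoc]
      abel
    have h1 : ‖E₀ * (N - 1)‖ ≤ 1 * r ^ 2 := by
      refine (Matrix.l2_opNorm_mul _ _).trans ?_
      gcongr
      · exact norm_le_one_of_isometry h00
      · exact hN2.trans hXr2
    have h2 : ‖E₁ * (X * N)‖ ≤ 1 * (r * 1) := by
      refine (Matrix.l2_opNorm_mul _ _).trans ?_
      gcongr
      · exact norm_le_one_of_isometry h11
      · exact (norm_mul_le _ _).trans (by gcongr)
    have h3 : 4 * L / s = 2 * r := by rw [hr]; ring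
    rw [e, h3]
    refine (norm_add_le _ _).trans ?_
    nlinarith
  · rw [hTHT]
    set R := X * a + (s : ℂ) • (X * b * X) - a * X with hR
    have hRX : R = (s : ℂ) ^ 2 • X + (s : ℂ) • b := by rw [hR, ← hX]; abel
    have hkR : k - (a - b * b) = (s : ℂ)⁻¹ • (b * R) := by
      rw [hRX, hk, Matrix.mul_add, smul_add, Matrix.mul_smul, Matrix.mul_smul, inv_smul_smul₀ hs0,
        smul_smul, pow_two, inv_mul_cancel_left₀ hs0]
      abel
    have hRn : ‖R‖ ≤ 4 * L ^ 2 * r := by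
      calc ‖R‖ ≤ ‖X * a‖ + ‖(s : ℂ) • (X * b * X)‖ + ‖a * X‖ :=
            (norm_sub_le _ _).trans (add_le_add (norm_add_le _ _) le_rfl)
        _ ≤ r * L + s * (r * L * r) + L * r := by
            rw [norm_smul, hns]
            gcongr
            · exact (norm_mul_le _ _).trans (by gcongr)
            · exact (norm_mul_le _ _).trans
                (mul_le_mul ((norm_mul_le _ _).trans (by gcongr)) hXr (norm_nonneg _)
                  (by positivity))
            · exact (norm_mul_le _ _).trans (by gcongr)
        _ = 2 * (L * r) + (r * s) * L * r := by ring
        _ ≤ 4 * L ^ 2 * r := by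
            rw [hrs]
            nlinarith [mul_le_mul_of_nonneg_right hLL hr0.le]
    have h1 : ‖k - (a - b * b)‖ ≤ 8 * L ^ 4 / s ^ 2 := by
      rw [hkR, norm_smul, norm_inv, hns]
      calc s⁻¹ * ‖b * R‖ ≤ s⁻¹ * (L * (4 * L ^ 2 * r)) := by
            gcongr
            exact (norm_mul_le _ _).trans (by gcongr)
        _ = 8 * L ^ 4 / s ^ 2 := by rw [hr]; field_simp; ring
    have h2 : ‖M * k * N - k‖ ≤ 24 * L ^ 4 / s ^ 2 := by
      have e : M * k * N - k = (M - 1) * k * N + k * (N - 1) := by noncomm_ring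
      rw [e]
      calc _ ≤ ‖(M - 1) * k * N‖ + ‖k * (N - 1)‖ := norm_add_le _ _
        _ ≤ r ^ 2 * (3 * L ^ 2) * 1 + 3 * L ^ 2 * r ^ 2 := by
            gcongr
            · refine (norm_mul_le _ _).trans
                (mul_le_mul ((norm_mul_le _ _).trans ?_) hN1 (norm_nonneg _) (by positivity))
              gcongr
              exact hM2.trans hXr2
            · refine (norm_mul_le _ _).trans ?_
              gcongr
              exact hN2.trans hXr2
        _ = 24 * L ^ 4 / s ^ 2 := by rw [hr]; field_simp; ring
    calc _ = ‖(M * k * N - k) + (k - (a - b * b))‖ := by congr 1; abel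
      _ ≤ _ := norm_add_le _ _
      _ ≤ 24 * L ^ 4 / s ^ 2 + 8 * L ^ 4 / s ^ 2 := add_le_add h2 h1
      _ = 32 * L ^ 4 / s ^ 2 := by ring

/-- The basis vector `|1⟩` of one qubit. -/
def anc1 : Fin 2 → ℂ := fun t => if t = 1 then 1 else 0

theorem prodIso_conjTranspose_mul {I J : Type*} [Fintype I] [DecidableEq I] [Fintype J]
    (u v : J → ℂ) :
    (prodIso (I := I) u)ᴴ * prodIso (I := I) v = (star u ⬝ᵥ v) • (1 : Matrix I I ℂ) := by
  ext i j
  simp only [Matrix.mul_apply, Matrix.conjTranspose_apply, prodIso, Fintype.sum_prod_type,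
    dotProduct, Matrix.smul_apply, Matrix.one_apply, Pi.star_apply]
  rw [Finset.sum_eq_single i (by intro k _ hk; simp [hk]) (by simp)]
  by_cases h : i = j <;> simp [h]

theorem prodIso_mul_conjTranspose_add {I : Type*} [Fintype I] [DecidableEq I] :
    prodIso (I := I) anc0 * (prodIso (I := I) anc0)ᴴ +
      prodIso (I := I) anc1 * (prodIso (I := I) anc1)ᴴ = 1 := by
  ext ⟨i, p⟩ ⟨j, q⟩
  simp only [Matrix.add_apply, Matrix.mul_apply, Matrix.conjTranspose_apply, prodIso, anc0, anc1,
    Matrix.one_apply, Prod.mk.injEq]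
  rw [Finset.sum_eq_single i (by intro k _ hk; simp [hk.symm]) (by simp),
    Finset.sum_eq_single i (by intro k _ hk; simp [hk.symm]) (by simp)]
  by_cases h : i = j <;> fin_cases p <;> fin_cases q <;> simp [h, eq_comm]

theorem kronecker_mul_prodIso {I J : Type*} [Fintype I] [DecidableEq I] [Fintype J]
    (A : Matrix I I ℂ) (C : Matrix J J ℂ) (v : J → ℂ) :
    (A ⊗ₖ C) * prodIso (I := I) v = prodIso (I := I) (C *ᵥ v) * A := by
  ext ⟨i, p⟩ j
  simp only [Matrix.mul_apply, Matrix.kroneckerMap_apply, prodIso, Fintype.sum_prod_type,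
    Matrix.mulVec, dotProduct]
  rw [Finset.sum_eq_single j (by intro k _ hk; simp [hk]) (by simp),
    Finset.sum_eq_single i (by intro k _ hk; simp [hk.symm]) (by simp)]
  simp only [if_true, Finset.sum_mul]
  exact Finset.sum_congr rfl fun x _ => by ring

/-- A block Hamiltonian `s²|1⟩⟨1| + a + s b⊗X` simulates `a - b²`. -/
theorem isSimulation_second_order {I : Type*} [Fintype I] [DecidableEq I] {a b : Matrix I I ℂ}
    {s L ε η : ℝ} (hah : aᴴ = a) (hbh : bᴴ = b) (hs : 0 < s) (hL : 1 ≤ L) (ha : ‖a‖ ≤ L)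
    (hb : ‖b‖ ≤ L) (hsL : 16 * L ^ 2 ≤ s ^ 2) (hη : 4 * L / s ≤ η)
    (hε : 32 * L ^ 4 / s ^ 2 ≤ ε) :
    IsSimulation
      ((s : ℂ) ^ 2 • ((1 : Matrix I I ℂ) ⊗ₖ proj1) + a ⊗ₖ (1 : Matrix (Fin 2) (Fin 2) ℂ)
        + (s : ℂ) • (b ⊗ₖ Xmat))
      (a - b * b) anc0 (s ^ 2 / 2) η ε := by
  set H := (s : ℂ) ^ 2 • ((1 : Matrix I I ℂ) ⊗ₖ proj1) + a ⊗ₖ (1 : Matrix (Fin 2) (Fin 2) ℂ)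
        + (s : ℂ) • (b ⊗ₖ Xmat) with hHdef
  have hproj : proj1ᴴ = proj1 := by
    ext i j; fin_cases i <;> fin_cases j <;> simp [proj1]
  have hXh : Xmatᴴ = Xmat := by
    ext i j; fin_cases i <;> fin_cases j <;> simp [Xmat]
  have hH : H.IsHermitian := by
    rw [Matrix.IsHermitian, hHdef]
    simp [Matrix.conjTranspose_add, Matrix.conjTranspose_smul, Matrix.conjTranspose_kronecker,
      hproj, hXh, hah, hbh]
  have p0 : proj1 *ᵥ anc0 = 0 := by
    ext i; fin_cases i <;> simp [proj1, anc0, Matrix.mulVec, dotProduct]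
  have p1 : proj1 *ᵥ anc1 = anc1 := by
    ext i; fin_cases i <;> simp [proj1, anc1, Matrix.mulVec, dotProduct]
  have x0 : Xmat *ᵥ anc0 = anc1 := by
    ext i; fin_cases i <;> simp [Xmat, anc0, anc1, Matrix.mulVec, dotProduct]
  have x1 : Xmat *ᵥ anc1 = anc0 := by
    ext i; fin_cases i <;> simp [Xmat, anc0, anc1, Matrix.mulVec, dotProduct]
  have hz : prodIso (I := I) (0 : Fin 2 → ℂ) = 0 := by
    ext; simp [prodIso]
  have d00 : star anc0 ⬝ᵥ anc0 = 1 := by simp [anc0, dotProduct]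
  have d11 : star anc1 ⬝ᵥ anc1 = 1 := by simp [anc1, dotProduct]
  have d01 : star anc0 ⬝ᵥ anc1 = 0 := by simp [anc0, anc1, dotProduct]
  have d10 : star anc1 ⬝ᵥ anc0 = 0 := by simp [anc0, anc1, dotProduct]
  obtain ⟨T, hTT, hTP, hTη, hTε⟩ := exists_isometry_low_energy (E₀ := prodIso (I := I) anc0)
    (E₁ := prodIso (I := I) anc1) (a := a) (b := b) (s := s) (L := L) hH
    (by rw [prodIso_conjTranspose_mul, d00, one_smul])
    (by rw [prodIso_conjTranspose_mul, d11, one_smul])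
    (by rw [prodIso_conjTranspose_mul, d01, zero_smul])
    (by rw [prodIso_conjTranspose_mul, d10, zero_smul])
    prodIso_mul_conjTranspose_add
    (by
      rw [hHdef, Matrix.add_mul, Matrix.add_mul, Matrix.smul_mul, Matrix.smul_mul,
        kronecker_mul_prodIso, kronecker_mul_prodIso, kronecker_mul_prodIso, p0, x0, hz,
        Matrix.one_mulVec, Matrix.zero_mul, smul_zero, zero_add])
    (by
      rw [hHdef, Matrix.add_mul, Matrix.add_mul, Matrix.smul_mul, Matrix.smul_mul,
        kronecker_mul_prodIso, kronecker_mul_prodIso, kronecker_mul_prodIso, p1, x1,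
        Matrix.one_mulVec, Matrix.mul_one]
      abel)
    hs hL ha hb hsL
  refine ⟨T, d00, hTT, hTP, hTη.trans hη, ?_⟩
  rw [← hTP]
  have e : T * Tᴴ * H * (T * Tᴴ) - T * (a - b * b) * Tᴴ
      = T * ((Tᴴ * H * T - (a - b * b)) * Tᴴ) := by
    simp only [Matrix.sub_mul, Matrix.mul_sub, Matrix.mul_assoc]
  rw [e]
  change ‖T * ((Tᴴ * H * T - (a - b * b)) * Tᴴ)‖ ≤ ε
  have hT1 := norm_le_one_of_isometry hTT
  calc _ ≤ ‖T‖ * (‖Tᴴ * H * T - (a - b * b)‖ * ‖Tᴴ‖) :=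
        (Matrix.l2_opNorm_mul _ _).trans
          (mul_le_mul_of_nonneg_left (Matrix.l2_opNorm_mul _ _) (norm_nonneg _))
    _ ≤ 1 * (‖Tᴴ * H * T - (a - b * b)‖ * 1) := by
        rw [Matrix.l2_opNorm_conjTranspose]
        gcongr
    _ ≤ ε := by rw [one_mul, mul_one]; exact hTε.trans hε

theorem norm_le_norm_kronecker_Xmat {I : Type*} [Fintype I] [DecidableEq I] (b : Matrix I I ℂ) :
    ‖b‖ ≤ ‖b ⊗ₖ Xmat‖ := by
  have x1 : Xmat *ᵥ anc1 = anc0 := by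
    ext i; fin_cases i <;> simp [Xmat, anc0, anc1, Matrix.mulVec, dotProduct]
  have h0 : (prodIso (I := I) anc0)ᴴ * prodIso (I := I) anc0 = 1 := by
    rw [prodIso_conjTranspose_mul]; simp [anc0, dotProduct]
  have h1 : (prodIso (I := I) anc1)ᴴ * prodIso (I := I) anc1 = 1 := by
    rw [prodIso_conjTranspose_mul]; simp [anc1, dotProduct]
  have e : b = (prodIso (I := I) anc0)ᴴ * ((b ⊗ₖ Xmat) * prodIso (I := I) anc1) := by
    rw [kronecker_mul_prodIso, x1, ← Matrix.mul_assoc, h0, Matrix.one_mul]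
  have n0 := norm_le_one_of_isometry h0
  have n1 := norm_le_one_of_isometry h1
  calc ‖b‖ = ‖(prodIso (I := I) anc0)ᴴ * ((b ⊗ₖ Xmat) * prodIso (I := I) anc1)‖ := by rw [← e]
    _ ≤ ‖(prodIso (I := I) anc0)ᴴ‖ * (‖b ⊗ₖ Xmat‖ * ‖prodIso (I := I) anc1‖) :=
        (Matrix.l2_opNorm_mul _ _).trans
          (mul_le_mul_of_nonneg_left (Matrix.l2_opNorm_mul _ _) (norm_nonneg _))
    _ ≤ 1 * (‖b ⊗ₖ Xmat‖ * 1) := by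
        rw [Matrix.l2_opNorm_conjTranspose]
        gcongr
    _ = ‖b ⊗ₖ Xmat‖ := by ring

end QSim

end

namespace QSim

/-- subdivision gadget.  There is a universal `c₀ > 0` such that for
commuting Hermitian `P_A, P_B` acting on disjoint sets of qubits of a register, adjoining one
ancilla `t` and setting `H₀ = |1⟩⟨1|_t`, `H₁ = H_else + (P_A² + P_B²)/2`,
`H₂ = (P_A − P_B)⊗X_t/√2`, the Hamiltonian `H̃ = ΔH₀ + H₁ + √Δ H₂` is a
`(Δ/2, η, ε)`-simulation of `H_else + P_A·P_B` (product encoding, ancilla state `|0⟩_t`)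
whenever `ε, η ∈ (0,1]` and `Δ ≥ c₀(Λ⁶/ε² + Λ²/η²)`, `Λ = max(‖H₁‖, ‖H₂‖, 1)`. -/
theorem subdivision_gadget :
    ∃ c₀ : ℝ, 0 < c₀ ∧
    ∀ (m : ℕ) (Helse : QOp m), Helseᴴ = Helse →
    ∀ (PA PB : QOp m), PAᴴ = PA → PBᴴ = PB →
    ∀ (SA SB : Finset (Fin m)), Disjoint SA SB → ActsOn PA SA → ActsOn PB SB →
    let H₁ : QOp m := Helse + (1 / 2 : ℂ) • (PA * PA + PB * PB)
    let H₂ : Matrix (QIdx m × Fin 2) (QIdx m × Fin 2) ℂ :=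
      (((Real.sqrt 2)⁻¹ : ℝ) : ℂ) • ((PA - PB) ⊗ₖ Xmat)
    let Λ : ℝ := max (opNorm H₁) (max (opNorm H₂) 1)
    ∀ ε η : ℝ, ε ∈ Set.Ioc (0 : ℝ) 1 → η ∈ Set.Ioc (0 : ℝ) 1 →
      ∀ Δ : ℝ, c₀ * (Λ ^ 6 / ε ^ 2 + Λ ^ 2 / η ^ 2) ≤ Δ →
        IsSimulation
          ((Δ : ℂ) • ((1 : QOp m) ⊗ₖ proj1) + H₁ ⊗ₖ (1 : Matrix (Fin 2) (Fin 2) ℂ)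
            + ((Real.sqrt Δ : ℝ) : ℂ) • H₂)
          (Helse + PA * PB) anc0 (Δ / 2) η ε := by
  refine ⟨32, by norm_num, ?_⟩
  intro m Helse hHelse PA PB hPA hPB SA SB hdisj hA hB H₁ H₂ Λ ε η hε hη Δ hΔ
  obtain ⟨hε0, hε1⟩ := hε
  obtain ⟨hη0, hη1⟩ := hη
  have hL : 1 ≤ Λ := (le_max_right _ _).trans (le_max_right _ _)
  have hL0 : 0 < Λ := by linarith
  have hL2 : 1 ≤ Λ ^ 2 := one_le_pow₀ hL
  have hΔη : 32 * Λ ^ 2 ≤ Δ * η ^ 2 := by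
    have h1 : 32 * (Λ ^ 2 / η ^ 2) ≤ Δ := by
      have : 0 ≤ Λ ^ 6 / ε ^ 2 := by positivity
      linarith
    rw [← mul_div_assoc] at h1
    exact (div_le_iff₀ (by positivity)).1 h1
  have hΔε : 32 * Λ ^ 6 ≤ Δ * ε ^ 2 := by
    have h1 : 32 * (Λ ^ 6 / ε ^ 2) ≤ Δ := by
      have : 0 ≤ Λ ^ 2 / η ^ 2 := by positivity
      linarith
    rw [← mul_div_assoc] at h1
    exact (div_le_iff₀ (by positivity)).1 h1
  have hΔ0 : 0 < Δ := by
    have : 0 < 32 * (Λ ^ 6 / ε ^ 2 + Λ ^ 2 / η ^ 2) := by positivity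
    linarith
  have hs : 0 < √Δ := Real.sqrt_pos.2 hΔ0
  have hs2 : √Δ ^ 2 = Δ := Real.sq_sqrt hΔ0.le
  have hcomm : PA * PB = PB * PA := ActsOn.commute hdisj hA hB
  set c : ℂ := (((Real.sqrt 2)⁻¹ : ℝ) : ℂ) with hc
  have hcc : c * c = 1 / 2 := by
    rw [hc, ← Complex.ofReal_mul, ← mul_inv, Real.mul_self_sqrt (by norm_num)]
    norm_num
  set b : QOp m := c • (PA - PB) with hb
  have hH₂ : H₂ = b ⊗ₖ Xmat := (Matrix.smul_kronecker _ _ _).symm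
  have htarget : Helse + PA * PB = H₁ - b * b := by
    have e : (PA - PB) * (PA - PB) = PA * PA + PB * PB - (2 : ℂ) • (PA * PB) := by
      rw [two_smul, sub_mul, mul_sub, mul_sub, ← hcomm]
      abel
    rw [hb, smul_mul_smul_comm, hcc, e, smul_sub, smul_smul]
    norm_num [H₁]
    abel
  have hah : H₁ᴴ = H₁ := by
    simp [H₁, Matrix.conjTranspose_add, Matrix.conjTranspose_smul, hHelse, hPA, hPB]
  have hbh : bᴴ = b := by
    simp [hb, hc, Matrix.conjTranspose_smul, hPA, hPB]
  have hbn : opNorm b ≤ Λ :=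
    (norm_le_norm_kronecker_Xmat b).trans (hH₂ ▸ (le_max_left _ _).trans (le_max_right _ _))
  have key := isSimulation_second_order (ε := ε) (η := η) hah hbh hs hL (le_max_left _ _) hbn
    (by rw [hs2]; nlinarith [mul_le_of_le_one_right hΔ0.le (pow_le_one₀ hη0.le hη1 (n := 2))])
    (by
      rw [div_le_iff₀ hs]
      refine le_of_sq_le_sq ?_ (by positivity)
      rw [mul_pow, mul_pow, hs2]
      nlinarith)
    (by
      rw [hs2, div_le_iff₀ hΔ0]
      have h1 : ε * (32 * Λ ^ 4) ≤ ε * (ε * Δ) := by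
        calc ε * (32 * Λ ^ 4) ≤ 1 * (32 * Λ ^ 4) := by gcongr
          _ ≤ 32 * Λ ^ 6 := by nlinarith [pow_pos hL0 4]
          _ ≤ ε * (ε * Δ) := by linarith
      exact le_of_mul_le_mul_left h1 hε0)
  rw [← hH₂, ← htarget, hs2, ← Complex.ofReal_pow, hs2] at key
  exact key

end QSim
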